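/- Let Y, N, G, R be random variables on a finite probability space taking values in finite types. Assume R is conditionally independent of the pair (Y, N) given G and that Y and N are independent. Then I(R; G) ≥ I(R; N) + I(R; Y). (This is the key inequality derived in the proof of the paper's Lemma 1 via the data processing inequality, the chain rule I(R;(Y,N)) = I(R;N) + I(R;Y|N), the identity H(Y|N) = H(Y) under independence, and the fact that conditioning reduces entropy.) -/

import Mathlib

open scoped BigOperators

/-- Joint/marginal probability mass of a random variable `X` on a finite space with
probability mass function `p`. -/
noncomputable def massOf {Ω : Type*} [Fintype Ω] (p : Ω → ℝ)
    {A : Type*} [DecidableEq A] (X : Ω → A) (x : A) : ℝ :=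
  ∑ ω, if X ω = x then p ω else 0

/-- Joint probability mass of a pair of random variables. -/
noncomputable def massOf2 {Ω : Type*} [Fintype Ω] (p : Ω → ℝ)
    {A B : Type*} [DecidableEq A] [DecidableEq B] (X : Ω → A) (Z : Ω → B) (x : A) (z : B) : ℝ :=
  ∑ ω, if X ω = x ∧ Z ω = z then p ω else 0

/-- Joint probability mass of a triple of random variables. -/
noncomputable def massOf3 {Ω : Type*} [Fintype Ω] (p : Ω → ℝ)
    {A B C : Type*} [DecidableEq A] [DecidableEq B] [DecidableEq C]
    (X : Ω → A) (Z : Ω → B) (W : Ω → C) (x : A) (z : B) (w : C) : ℝ :=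
  ∑ ω, if X ω = x ∧ Z ω = z ∧ W ω = w then p ω else 0

/-- Shannon entropy `H(X)`. -/
noncomputable def entropy {Ω : Type*} [Fintype Ω] (p : Ω → ℝ)
    {A : Type*} [Fintype A] [DecidableEq A] (X : Ω → A) : ℝ :=
  -∑ x, massOf p X x * Real.log (massOf p X x)

/-- Conditional Shannon entropy `H(X|Z)`. -/
noncomputable def condEntropy {Ω : Type*} [Fintype Ω] (p : Ω → ℝ)
    {A B : Type*} [Fintype A] [DecidableEq A] [Fintype B] [DecidableEq B]
    (X : Ω → A) (Z : Ω → B) : ℝ :=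
  -∑ x, ∑ z, massOf2 p X Z x z * Real.log (massOf2 p X Z x z / massOf p Z z)

/-- Mutual information `I(X;Z)` (terms with zero probability vanish since they are
multiplied by the zero mass). -/
noncomputable def mutInfo {Ω : Type*} [Fintype Ω] (p : Ω → ℝ)
    {A B : Type*} [Fintype A] [DecidableEq A] [Fintype B] [DecidableEq B]
    (X : Ω → A) (Z : Ω → B) : ℝ :=
  ∑ x, ∑ z, massOf2 p X Z x z *
    Real.log (massOf2 p X Z x z / (massOf p X x * massOf p Z z))

/-- Conditional mutual information `I(X;Z|W)`, using
`p(x,z|w)/(p(x|w)p(z|w)) = p(x,z,w)p(w)/(p(x,w)p(z,w))`. -/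
noncomputable def condMutInfo {Ω : Type*} [Fintype Ω] (p : Ω → ℝ)
    {A B C : Type*} [Fintype A] [DecidableEq A] [Fintype B] [DecidableEq B]
    [Fintype C] [DecidableEq C] (X : Ω → A) (Z : Ω → B) (W : Ω → C) : ℝ :=
  ∑ x, ∑ z, ∑ w, massOf3 p X Z W x z w *
    Real.log ((massOf3 p X Z W x z w * massOf p W w) /
      (massOf2 p X W x w * massOf2 p Z W z w))

/-- `X` and `Z` are independent: `p(x,z) = p(x) p(z)`. -/
def IndepRV {Ω : Type*} [Fintype Ω] (p : Ω → ℝ)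
    {A B : Type*} [DecidableEq A] [DecidableEq B] (X : Ω → A) (Z : Ω → B) : Prop :=
  ∀ x z, massOf2 p X Z x z = massOf p X x * massOf p Z z

/-- `X` and `Z` are conditionally independent given `W`:
`p(x,z,w) p(w) = p(x,w) p(z,w)`. -/
def CondIndepRV {Ω : Type*} [Fintype Ω] (p : Ω → ℝ)
    {A B C : Type*} [DecidableEq A] [DecidableEq B] [DecidableEq C]
    (X : Ω → A) (Z : Ω → B) (W : Ω → C) : Prop :=
  ∀ x z w, massOf3 p X Z W x z w * massOf p W w = massOf2 p X W x w * massOf2 p Z W z w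

section MassOf

variable {Ω : Type*} [Fintype Ω] {p : Ω → ℝ} {A B C : Type*}
  [DecidableEq A] [DecidableEq B] [DecidableEq C]

theorem massOf2_eq_massOf_prodMk (X : Ω → A) (Z : Ω → B) (x : A) (z : B) :
    massOf2 p X Z x z = massOf p (fun ω => (X ω, Z ω)) (x, z) := by
  simp [massOf2, massOf]

theorem massOf3_eq_massOf_prodMk (X : Ω → A) (Z : Ω → B) (W : Ω → C) (x : A) (z : B) (w : C) :
    massOf3 p X Z W x z w = massOf p (fun ω => (X ω, Z ω, W ω)) (x, z, w) := by
  simp [massOf3, massOf]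

theorem massOf_nonneg (hp : ∀ ω, 0 ≤ p ω) (X : Ω → A) (x : A) : 0 ≤ massOf p X x :=
  Finset.sum_nonneg fun ω _ => by split_ifs <;> simp [hp ω]

theorem massOf2_nonneg (hp : ∀ ω, 0 ≤ p ω) (X : Ω → A) (Z : Ω → B) (x : A) (z : B) :
    0 ≤ massOf2 p X Z x z :=
  massOf2_eq_massOf_prodMk X Z x z ▸ massOf_nonneg hp _ _

theorem massOf_apply_pos (hp : ∀ ω, 0 ≤ p ω) (X : Ω → A) {ω : Ω} (hω : 0 < p ω) :
    0 < massOf p X (X ω) :=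
  Finset.sum_pos' (fun ω' _ => by split_ifs <;> simp [hp ω']) ⟨ω, Finset.mem_univ _, by simpa⟩

theorem massOf2_apply_pos (hp : ∀ ω, 0 ≤ p ω) (X : Ω → A) (Z : Ω → B) {ω : Ω} (hω : 0 < p ω) :
    0 < massOf2 p X Z (X ω) (Z ω) :=
  massOf2_eq_massOf_prodMk (p := p) X Z _ _ ▸ massOf_apply_pos hp (fun ω => (X ω, Z ω)) hω

theorem sum_massOf_mul [Fintype A] (X : Ω → A) (f : A → ℝ) :
    ∑ x, massOf p X x * f x = ∑ ω, p ω * f (X ω) := by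
  simp only [massOf, Finset.sum_mul]
  rw [Finset.sum_comm]
  simp [ite_mul]

theorem sum_massOf2_mul [Fintype A] [Fintype B] (X : Ω → A) (Z : Ω → B) (f : A → B → ℝ) :
    ∑ x, ∑ z, massOf2 p X Z x z * f x z = ∑ ω, p ω * f (X ω) (Z ω) := by
  simp only [massOf2_eq_massOf_prodMk]
  rw [← sum_massOf_mul (fun ω => (X ω, Z ω)) (fun a => f a.1 a.2), Fintype.sum_prod_type]

theorem sum_massOf3_mul [Fintype A] [Fintype B] [Fintype C] (X : Ω → A) (Z : Ω → B) (W : Ω → C)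
    (f : A → B → C → ℝ) :
    ∑ x, ∑ z, ∑ w, massOf3 p X Z W x z w * f x z w = ∑ ω, p ω * f (X ω) (Z ω) (W ω) := by
  simp only [massOf3_eq_massOf_prodMk]
  rw [← sum_massOf_mul (fun ω => (X ω, Z ω, W ω)) (fun a => f a.1 a.2.1 a.2.2)]
  simp only [Fintype.sum_prod_type]

theorem sum_massOf [Fintype A] (X : Ω → A) : ∑ x, massOf p X x = ∑ ω, p ω := by
  simpa using sum_massOf_mul (p := p) X fun _ => 1

theorem sum_massOf2_right [Fintype B] (X : Ω → A) (Z : Ω → B) (x : A) :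
    ∑ z, massOf2 p X Z x z = massOf p X x := by
  simp only [massOf2, massOf]
  rw [Finset.sum_comm]
  simp [ite_and]

theorem mutInfo_eq_sum [Fintype A] [Fintype B] (X : Ω → A) (Z : Ω → B) :
    mutInfo p X Z = ∑ ω, p ω * Real.log (massOf2 p X Z (X ω) (Z ω) /
      (massOf p X (X ω) * massOf p Z (Z ω))) :=
  sum_massOf2_mul X Z fun x z => Real.log (massOf2 p X Z x z / (massOf p X x * massOf p Z z))

end MassOf

theorem sum_massOf2_mul_massOf2_div {Ω : Type*} [Fintype Ω] {p : Ω → ℝ}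
    {A B C : Type*} [Fintype A] [DecidableEq A] [Fintype B] [DecidableEq B]
    [Fintype C] [DecidableEq C] (X : Ω → A) (Z : Ω → B) (W : Ω → C) :
    ∑ x, ∑ a : B × C, massOf2 p X Z x a.1 * massOf2 p X W x a.2 / massOf p X x = ∑ ω, p ω := by
  rw [← sum_massOf X]
  refine Finset.sum_congr rfl fun x _ => ?_
  rw [← Finset.sum_div, Fintype.sum_prod_type]
  simp only [← Finset.mul_sum, ← Finset.sum_mul, sum_massOf2_right]
  exact mul_self_div_self _

/-- The mean of the reciprocal of the likelihood ratio
`p(r,g) p(r) p(y,n) / (p(g) p(r,n) p(r,y))` is at most one. -/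
theorem sum_mul_inv_likelihood_le {Ω : Type*} [Fintype Ω] {p : Ω → ℝ} (hp : ∀ ω, 0 ≤ p ω)
    {𝒴 𝒩 𝒢 ℛ : Type*}
    [Fintype 𝒴] [DecidableEq 𝒴] [Fintype 𝒩] [DecidableEq 𝒩]
    [Fintype 𝒢] [DecidableEq 𝒢] [Fintype ℛ] [DecidableEq ℛ]
    {Y : Ω → 𝒴} {N : Ω → 𝒩} {G : Ω → 𝒢} {R : Ω → ℛ}
    (hMarkov : CondIndepRV p R (fun ω => (Y ω, N ω)) G) :
    ∑ ω, p ω * (massOf p G (G ω) * massOf2 p R Y (R ω) (Y ω) * massOf2 p R N (R ω) (N ω) /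
      (massOf2 p R G (R ω) (G ω) * massOf p R (R ω) *
        massOf p (fun ω => (Y ω, N ω)) (Y ω, N ω))) ≤ ∑ ω, p ω := by
  rw [← sum_massOf3_mul R (fun ω => (Y ω, N ω)) G fun r a g =>
    massOf p G g * massOf2 p R Y r a.1 * massOf2 p R N r a.2 /
      (massOf2 p R G r g * massOf p R r * massOf p (fun ω => (Y ω, N ω)) a),
    ← sum_massOf2_mul_massOf2_div R Y N]
  refine Finset.sum_le_sum fun r _ => Finset.sum_le_sum fun a _ => ?_
  set c := massOf2 p R Y r a.1 * massOf2 p R N r a.2 / massOf p R r with hc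
  have hc0 : 0 ≤ c := div_nonneg
    (mul_nonneg (massOf2_nonneg hp ..) (massOf2_nonneg hp ..)) (massOf_nonneg hp ..)
  have hle : ∀ g, massOf3 p R (fun ω => (Y ω, N ω)) G r a g *
      (massOf p G g * massOf2 p R Y r a.1 * massOf2 p R N r a.2 /
        (massOf2 p R G r g * massOf p R r * massOf p (fun ω => (Y ω, N ω)) a)) ≤
      massOf2 p (fun ω => (Y ω, N ω)) G a g / massOf p (fun ω => (Y ω, N ω)) a * c := by
    intro g
    by_cases h : massOf2 p R G r g = 0
    · rw [h, zero_mul, zero_mul, div_zero, mul_zero]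
      exact mul_nonneg (div_nonneg (massOf2_nonneg hp ..) (massOf_nonneg hp ..)) hc0
    · refine le_of_eq ?_
      calc
        _ = (massOf3 p R (fun ω => (Y ω, N ω)) G r a g * massOf p G g) / massOf2 p R G r g /
            massOf p (fun ω => (Y ω, N ω)) a * c := by rw [hc]; ring
        _ = _ := by rw [hMarkov r a g, mul_div_cancel_left₀ _ h]
  refine (Finset.sum_le_sum fun g _ => hle g).trans ?_
  rw [← Finset.sum_mul, ← Finset.sum_div, sum_massOf2_right]
  exact mul_le_of_le_one_left hc0 (div_self_le_one _)

/-- Key inequality in the proof of Lemma 1: under the Markov chain `(Y,N) → G → R`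
and independence of `Y` and `N`, `I(R;G) ≥ I(R;N) + I(R;Y)`. -/
theorem mutInfo_ge_add_of_markov
    {Ω : Type*} [Fintype Ω] (p : Ω → ℝ)
    (hp0 : ∀ ω, 0 ≤ p ω) (hp1 : ∑ ω, p ω = 1)
    {𝒴 𝒩 𝒢 ℛ : Type*}
    [Fintype 𝒴] [DecidableEq 𝒴] [Fintype 𝒩] [DecidableEq 𝒩]
    [Fintype 𝒢] [DecidableEq 𝒢] [Fintype ℛ] [DecidableEq ℛ]
    (Y : Ω → 𝒴) (N : Ω → 𝒩) (G : Ω → 𝒢) (R : Ω → ℛ)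
    (hMarkov : CondIndepRV p R (fun ω => (Y ω, N ω)) G)
    (hIndep : IndepRV p Y N) :
    mutInfo p R N + mutInfo p R Y ≤ mutInfo p R G := by
  rw [mutInfo_eq_sum, mutInfo_eq_sum, mutInfo_eq_sum, ← Finset.sum_add_distrib, ← sub_nonpos,
    ← Finset.sum_sub_distrib]
  refine le_trans ?_ (sub_nonpos.2 (sum_mul_inv_likelihood_le hp0 hMarkov))
  rw [← Finset.sum_sub_distrib]
  refine Finset.sum_le_sum fun ω _ => ?_
  rcases (hp0 ω).eq_or_lt with h | h
  · simp [← h]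
  have hY := massOf_apply_pos hp0 Y h
  have hN := massOf_apply_pos hp0 N h
  have hG := massOf_apply_pos hp0 G h
  have hR := massOf_apply_pos hp0 R h
  have hRY := massOf2_apply_pos hp0 R Y h
  have hRN := massOf2_apply_pos hp0 R N h
  have hRG := massOf2_apply_pos hp0 R G h
  rw [← massOf2_eq_massOf_prodMk, hIndep, ← mul_add, ← mul_sub, ← mul_sub_one]
  refine mul_le_mul_of_nonneg_left ?_ h.le
  rw [← Real.log_mul (by positivity) (by positivity), ← Real.log_div (by positivity) (by positivity)]
  refine (Real.log_le_sub_one_of_pos (by positivity)).trans_eq ?_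
  field_simp
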